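/- Let m ≥ 2, 0 < a ≤ 1/4, and 1/m < α < 1/(m−1). Let (z_i)_{i∈ℕ} be an enumeration of ℤ^m in ℝ^m, set r_i = a i^{-α}, and let Ω = ⋃_{i∈ℕ} B(z_i; r_i). Let F_Ω(t) = |Ω| − H_Ω(t) denote the heat loss. Then, as t ↓ 0, F_Ω(t) − d_{α,m} t^{(mα−1)/(2α)} = O(t^{1/2}), where d_{α,m} = 2^{m−1−1/α} π^{-m/2} α^{-1} Γ((2mα−1)/(2α)) a^{1/α} ∫_{B(0;1)} ∫_{ℝ^m \ B(0;1)} |x−y|^{(1−2mα)/α} dy dx and Γ is the Gamma function. -/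

import Mathlib

open MeasureTheory Metric ENNReal

/-- The heat content of an open set `Ω ⊆ ℝᵐ` at time `t`, computed with the Euclidean
heat kernel `p(x,y;t) = (4πt)^{-m/2} e^{-|x-y|²/(4t)}`. -/
noncomputable def heatContent {m : ℕ} (Ω : Set (EuclideanSpace ℝ (Fin m))) (t : ℝ) :
    ℝ≥0∞ :=
  ∫⁻ x in Ω, ∫⁻ y in Ω,
    ENNReal.ofReal ((4 * Real.pi * t) ^ (-(m : ℝ) / 2) * Real.exp (-dist x y ^ 2 / (4 * t)))

/-- `z : ℕ → ℝᵐ` is an enumeration of the integer lattice `ℤᵐ ⊆ ℝᵐ`. -/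
def IsLatticeEnum (m : ℕ) (z : ℕ → EuclideanSpace ℝ (Fin m)) : Prop :=
  Function.Injective z ∧
    Set.range z = {x : EuclideanSpace ℝ (Fin m) | ∀ j : Fin m, ∃ k : ℤ, x j = (k : ℝ)}

/-- The Gaussian density `(4πt)^{-m/2} e^{-|w|²/(4t)}` on `ℝᵐ`. -/
noncomputable def gaussKernel {m : ℕ} (t : ℝ) (w : EuclideanSpace ℝ (Fin m)) : ℝ≥0∞ :=
  ENNReal.ofReal ((4 * Real.pi * t) ^ (-(m : ℝ) / 2) * Real.exp (-‖w‖ ^ 2 / (4 * t)))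

/-- The amount of heat that has moved from `A` to `B` at time `t`. -/
noncomputable def heatFlow {m : ℕ} (t : ℝ) (A B : Set (EuclideanSpace ℝ (Fin m))) : ℝ≥0∞ :=
  ∫⁻ x in A, ∫⁻ y in B, gaussKernel t (x - y)

section HeatKernel

variable {m : ℕ} {t : ℝ}

theorem measurable_gaussKernel :
    Measurable (gaussKernel t : EuclideanSpace ℝ (Fin m) → ℝ≥0∞) := by
  unfold gaussKernel
  fun_prop

theorem measurable_gaussKernel_sub :
    Measurable (Function.uncurry fun x y : EuclideanSpace ℝ (Fin m) => gaussKernel t (x - y)) :=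
  measurable_gaussKernel.comp (measurable_fst.sub measurable_snd)

theorem measurable_setLIntegral_gaussKernel (B : Set (EuclideanSpace ℝ (Fin m))) :
    Measurable fun x => ∫⁻ y in B, gaussKernel t (x - y) :=
  measurable_gaussKernel_sub.lintegral_prod_right'

theorem gaussKernel_neg (w : EuclideanSpace ℝ (Fin m)) :
    gaussKernel t (-w) = gaussKernel t w := by
  simp [gaussKernel]

theorem heatContent_eq_heatFlow (Ω : Set (EuclideanSpace ℝ (Fin m))) :
    heatContent Ω t = heatFlow t Ω Ω := by
  simp only [heatContent, heatFlow, gaussKernel, dist_eq_norm]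

theorem lintegral_gaussKernel (ht : 0 < t) :
    ∫⁻ w : EuclideanSpace ℝ (Fin m), gaussKernel t w = 1 := by
  have hb : 0 < 1 / (4 * t) := by positivity
  have key := GaussianFourier.integral_rexp_neg_mul_sq_norm (V := EuclideanSpace ℝ (Fin m)) hb
  have hint : Integrable fun w : EuclideanSpace ℝ (Fin m) =>
      Real.exp (-(1 / (4 * t)) * ‖w‖ ^ 2) := by
    refine Integrable.of_integral_ne_zero ?_
    rw [key]
    positivity
  have hform : ∀ w : EuclideanSpace ℝ (Fin m),
      (4 * Real.pi * t) ^ (-(m : ℝ) / 2) * Real.exp (-‖w‖ ^ 2 / (4 * t)) =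
        (4 * Real.pi * t) ^ (-(m : ℝ) / 2) * Real.exp (-(1 / (4 * t)) * ‖w‖ ^ 2) := by
    intro w
    congr 2
    ring
  simp only [gaussKernel, hform]
  rw [← ofReal_integral_eq_lintegral_ofReal (hint.const_mul _)
    (Filter.Eventually.of_forall fun w => by positivity), integral_const_mul, key,
    finrank_euclideanSpace_fin]
  have h4 : Real.pi / (1 / (4 * t)) = 4 * Real.pi * t := by field_simp
  rw [h4, neg_div, Real.rpow_neg (by positivity), inv_mul_cancel₀ (by positivity),
    ENNReal.ofReal_one]

theorem lintegral_gaussKernel_sub (ht : 0 < t) (x : EuclideanSpace ℝ (Fin m)) :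
    ∫⁻ y, gaussKernel t (x - y) = 1 := by
  rw [lintegral_sub_left_eq_self (gaussKernel t) x, lintegral_gaussKernel ht]

theorem setLIntegral_gaussKernel_le_one (ht : 0 < t) (x : EuclideanSpace ℝ (Fin m))
    (B : Set (EuclideanSpace ℝ (Fin m))) : ∫⁻ y in B, gaussKernel t (x - y) ≤ 1 :=
  (setLIntegral_le_lintegral _ _).trans_eq (lintegral_gaussKernel_sub ht x)

theorem gaussKernel_le (ht : 0 < t) (w : EuclideanSpace ℝ (Fin m)) :
    gaussKernel t w ≤ ENNReal.ofReal ((4 * Real.pi * t) ^ (-(m : ℝ) / 2)) := by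
  refine ENNReal.ofReal_le_ofReal (mul_le_of_le_one_right (by positivity) ?_)
  rw [Real.exp_le_one_iff]
  exact div_nonpos_of_nonpos_of_nonneg (by nlinarith [sq_nonneg ‖w‖]) (by positivity)

theorem gaussKernel_eq_mul_gaussKernel_two_mul (ht : 0 < t) (w : EuclideanSpace ℝ (Fin m)) :
    gaussKernel t w = ENNReal.ofReal (2 ^ ((m : ℝ) / 2) * Real.exp (-‖w‖ ^ 2 / (8 * t))) *
      gaussKernel (2 * t) w := by
  rw [gaussKernel, gaussKernel, ← ENNReal.ofReal_mul (by positivity)]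
  congr 1
  have h1 : 4 * Real.pi * (2 * t) = 2 * (4 * Real.pi * t) := by ring
  have h2 : -‖w‖ ^ 2 / (4 * t) = -‖w‖ ^ 2 / (8 * t) + -‖w‖ ^ 2 / (4 * (2 * t)) := by
    field_simp; ring
  rw [h1, h2, Real.exp_add, Real.mul_rpow (x := 2) (by norm_num) (by positivity), neg_div,
    Real.rpow_neg (by norm_num : (0 : ℝ) ≤ 2)]
  have : (2 : ℝ) ^ ((m : ℝ) / 2) ≠ 0 := by positivity
  field_simp

theorem mul_exp_neg_sq_div_le (ht : 0 < t) (s : ℝ) :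
    s * Real.exp (-s ^ 2 / (8 * t)) ≤ 2 * √t := by
  have h1 : 1 + s ^ 2 / (8 * t) ≤ Real.exp (s ^ 2 / (8 * t)) := by
    linarith [Real.add_one_le_exp (s ^ 2 / (8 * t))]
  have hst : 0 < √t := Real.sqrt_pos.2 ht
  have h2 : s ≤ 2 * √t * (1 + s ^ 2 / (8 * t)) := by
    have h3 : 2 * √t * (1 + s ^ 2 / (8 * t)) = 2 * √t + s ^ 2 / (4 * √t) := by
      nth_rewrite 2 [← Real.sq_sqrt ht.le]
      field_simp
      ring
    rw [h3, ← sub_nonneg]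
    have h4 : 2 * √t + s ^ 2 / (4 * √t) - s = ((s - 2 * √t) ^ 2 + 4 * √t ^ 2) / (4 * √t) := by
      field_simp
      ring
    rw [h4]
    positivity
  rw [neg_div, Real.exp_neg, ← div_eq_mul_inv, div_le_iff₀ (Real.exp_pos _)]
  exact h2.trans (by gcongr)

/-- The first absolute moment of the Gaussian density is `O(√t)`. -/
theorem lintegral_gaussKernel_mul_norm_le (ht : 0 < t) :
    ∫⁻ w : EuclideanSpace ℝ (Fin m), gaussKernel t w * ENNReal.ofReal ‖w‖ ≤
      ENNReal.ofReal (2 ^ ((m : ℝ) / 2) * (2 * √t)) := by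
  calc ∫⁻ w : EuclideanSpace ℝ (Fin m), gaussKernel t w * ENNReal.ofReal ‖w‖
      ≤ ∫⁻ w : EuclideanSpace ℝ (Fin m),
          ENNReal.ofReal (2 ^ ((m : ℝ) / 2) * (2 * √t)) * gaussKernel (2 * t) w := by
        refine lintegral_mono fun w => ?_
        dsimp only
        rw [gaussKernel_eq_mul_gaussKernel_two_mul ht, mul_right_comm,
          ← ENNReal.ofReal_mul (by positivity), mul_assoc, mul_comm (Real.exp _)]
        gcongr ENNReal.ofReal (_ * ?_) * _
        exact mul_exp_neg_sq_div_le ht _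
    _ = ENNReal.ofReal (2 ^ ((m : ℝ) / 2) * (2 * √t)) := by
        rw [lintegral_const_mul _ measurable_gaussKernel, lintegral_gaussKernel (by positivity),
          mul_one]

/-- The Gaussian mass at distance at least `1/2` is `O(√t)`. -/
theorem setLIntegral_gaussKernel_far_le (ht : 0 < t) (ht1 : t ≤ 1)
    (x : EuclideanSpace ℝ (Fin m)) {B : Set (EuclideanSpace ℝ (Fin m))} (hB : MeasurableSet B)
    (hfar : ∀ y ∈ B, 1 / 2 ≤ ‖x - y‖) :
    ∫⁻ y in B, gaussKernel t (x - y) ≤ ENNReal.ofReal (2 ^ ((m : ℝ) / 2) * (32 * √t)) := by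
  calc ∫⁻ y in B, gaussKernel t (x - y)
      ≤ ∫⁻ y in B, ENNReal.ofReal (2 ^ ((m : ℝ) / 2) * (32 * √t)) *
          gaussKernel (2 * t) (x - y) := by
        refine setLIntegral_mono' hB fun y hy => ?_
        rw [gaussKernel_eq_mul_gaussKernel_two_mul ht]
        gcongr
        have h1 : 1 / (32 * t) ≤ ‖x - y‖ ^ 2 / (8 * t) := by
          rw [div_le_div_iff₀ (by positivity) (by positivity)]
          nlinarith [mul_le_mul_of_nonneg_left (pow_le_pow_left₀ (by norm_num) (hfar y hy) 2) ht.le]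
        have h2 : 1 / (32 * t) ≤ Real.exp (‖x - y‖ ^ 2 / (8 * t)) := by
          linarith [Real.add_one_le_exp (‖x - y‖ ^ 2 / (8 * t))]
        rw [neg_div, Real.exp_neg]
        calc (Real.exp (‖x - y‖ ^ 2 / (8 * t)))⁻¹ ≤ (1 / (32 * t))⁻¹ := by gcongr
          _ = 32 * t := by rw [one_div, inv_inv]
          _ ≤ 32 * √t := by
            gcongr
            exact Real.le_sqrt_of_sq_le (by nlinarith)
    _ ≤ ENNReal.ofReal (2 ^ ((m : ℝ) / 2) * (32 * √t)) := by
        rw [lintegral_const_mul _ (measurable_gaussKernel_sub.of_uncurry_left (x := x))]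
        exact mul_le_of_le_one_right' (setLIntegral_gaussKernel_le_one (by positivity) x B)

theorem heatFlow_comm (A B : Set (EuclideanSpace ℝ (Fin m))) :
    heatFlow t A B = heatFlow t B A := by
  unfold heatFlow
  rw [lintegral_lintegral_swap measurable_gaussKernel_sub.aemeasurable]
  exact lintegral_congr fun y => lintegral_congr fun x => by rw [← gaussKernel_neg, neg_sub]

theorem heatFlow_union_right {A B C : Set (EuclideanSpace ℝ (Fin m))} (hC : MeasurableSet C)
    (h : Disjoint B C) : heatFlow t A (B ∪ C) = heatFlow t A B + heatFlow t A C := by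
  unfold heatFlow
  simp_rw [lintegral_union hC h]
  rw [lintegral_add_left (measurable_setLIntegral_gaussKernel B)]

theorem heatFlow_union_left {A B C : Set (EuclideanSpace ℝ (Fin m))} (hB : MeasurableSet B)
    (h : Disjoint A B) : heatFlow t (A ∪ B) C = heatFlow t A C + heatFlow t B C := by
  unfold heatFlow
  rw [lintegral_union hB h]

theorem heatFlow_univ_right (ht : 0 < t) (A : Set (EuclideanSpace ℝ (Fin m))) :
    heatFlow t A Set.univ = volume A := by
  simp [heatFlow, lintegral_gaussKernel_sub ht]

theorem heatFlow_add_compl (ht : 0 < t) (A : Set (EuclideanSpace ℝ (Fin m)))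
    {B : Set (EuclideanSpace ℝ (Fin m))} (hB : MeasurableSet B) :
    heatFlow t A B + heatFlow t A Bᶜ = volume A := by
  rw [← heatFlow_union_right hB.compl disjoint_compl_right, Set.union_compl_self,
    heatFlow_univ_right ht]

theorem heatFlow_le_volume (ht : 0 < t) (A B : Set (EuclideanSpace ℝ (Fin m))) :
    heatFlow t A B ≤ volume A := by
  rw [← heatFlow_univ_right ht A]
  exact lintegral_mono fun x => lintegral_mono_set (Set.subset_univ B)

theorem heatFlow_le_mul_volume_sq (ht : 0 < t) (A : Set (EuclideanSpace ℝ (Fin m))) :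
    heatFlow t A A ≤ ENNReal.ofReal ((4 * Real.pi * t) ^ (-(m : ℝ) / 2)) * volume A ^ 2 := by
  calc heatFlow t A A
      ≤ ∫⁻ _ in A, ∫⁻ _ in A, ENNReal.ofReal ((4 * Real.pi * t) ^ (-(m : ℝ) / 2)) :=
        lintegral_mono fun x => lintegral_mono fun y => gaussKernel_le ht _
    _ = _ := by simp only [setLIntegral_const]; ring

theorem heatFlow_le_far (ht : 0 < t) (ht1 : t ≤ 1) {A B : Set (EuclideanSpace ℝ (Fin m))}
    (hA : MeasurableSet A) (hB : MeasurableSet B)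
    (hfar : ∀ x ∈ A, ∀ y ∈ B, 1 / 2 ≤ ‖x - y‖) :
    heatFlow t A B ≤ volume A * ENNReal.ofReal (2 ^ ((m : ℝ) / 2) * (32 * √t)) := by
  calc heatFlow t A B
      ≤ ∫⁻ _ in A, ENNReal.ofReal (2 ^ ((m : ℝ) / 2) * (32 * √t)) :=
        setLIntegral_mono' hA fun x hx => setLIntegral_gaussKernel_far_le ht ht1 x hB (hfar x hx)
    _ = _ := by rw [setLIntegral_const, mul_comm]

end HeatKernel

/-- The heat loss of a ball of radius `ρ` in `ℝᵐ` at time `t`. -/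
noncomputable def ballHeatLoss (m : ℕ) (t ρ : ℝ) : ℝ≥0∞ :=
  heatFlow t (ball (0 : EuclideanSpace ℝ (Fin m)) ρ) (ball 0 ρ)ᶜ

/-- A function whose decrease over `[x, y]` is at most quadratic in `y - x` is monotone. -/
theorem le_of_le_add_mul_sq {f : ℝ → ℝ} {C r R : ℝ}
    (hf : ∀ x y, r ≤ x → x ≤ y → y ≤ R → f x ≤ f y + C * (y - x) ^ 2) (hrR : r ≤ R) :
    f r ≤ f R := by
  have hstep : ∀ N : ℕ, 0 < N → f r ≤ f R + C * (R - r) ^ 2 / N := by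
    intro N hN
    have hN' : (0 : ℝ) < N := by exact_mod_cast hN
    set δ := (R - r) / N with hδ
    have hδ0 : 0 ≤ δ := div_nonneg (by linarith) hN'.le
    have hδN : N * δ = R - r := by rw [hδ]; field_simp
    have hind : ∀ k : ℕ, k ≤ N → f r ≤ f (r + k * δ) + k * (C * δ ^ 2) := by
      intro k
      induction k with
      | zero => intro _; simp
      | succ k ih =>
        intro hk
        have hkN : ((k + 1 : ℕ) : ℝ) * δ ≤ R - r := by
          rw [← hδN]
          gcongr
        push_cast at hkN ⊢
        have h := hf (r + k * δ) (r + (k + 1) * δ) (by nlinarith [k.cast_nonneg (α := ℝ)])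
          (by nlinarith) (by linarith)
        have h' := ih (by omega)
        have heq : r + (k + 1) * δ - (r + k * δ) = δ := by ring
        rw [heq] at h
        linarith
    have hfin := hind N le_rfl
    rw [hδN, add_sub_cancel] at hfin
    have heq : N * (C * δ ^ 2) = C * (R - r) ^ 2 / N := by
      rw [← hδN]
      field_simp
    rwa [heq] at hfin
  refine ge_of_tendsto (x := Filter.atTop) (a := f R)
    (f := fun N : ℕ => f R + C * (R - r) ^ 2 / N) ?_ ?_
  · simpa using (tendsto_const_nhds (x := f R)).add
      (tendsto_const_div_atTop_nhds_zero_nat (C * (R - r) ^ 2))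
  · exact (Filter.eventually_gt_atTop 0).mono hstep

section BallHeatLoss

variable {m : ℕ} {t : ℝ}

theorem heatFlow_ball_compl (z : EuclideanSpace ℝ (Fin m)) (ρ : ℝ) :
    heatFlow t (ball z ρ) (ball z ρ)ᶜ = ballHeatLoss m t ρ := by
  have hpre : (fun x => x + z) ⁻¹' ball z ρ = ball 0 ρ := by
    ext x
    simp
  have hmp := measurePreserving_add_right (volume : Measure (EuclideanSpace ℝ (Fin m))) z
  unfold ballHeatLoss heatFlow
  rw [← hmp.setLIntegral_comp_preimage_emb (measurableEmbedding_addRight z) _ (ball z ρ), hpre]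
  refine lintegral_congr fun x => ?_
  rw [← hmp.setLIntegral_comp_preimage_emb (measurableEmbedding_addRight z) _ (ball z ρ)ᶜ,
    Set.preimage_compl, hpre]
  simp only [add_sub_add_right_eq_sub]

theorem volume_ball_eq [NeZero m] (x : EuclideanSpace ℝ (Fin m)) {ρ : ℝ} (hρ : 0 ≤ ρ) :
    volume (ball x ρ) =
      ENNReal.ofReal (ρ ^ m) * volume (ball (0 : EuclideanSpace ℝ (Fin m)) 1) := by
  rw [Measure.addHaar_ball _ _ hρ, finrank_euclideanSpace_fin]

theorem volume_annulus_le [NeZero m] {r R : ℝ} (hr : 0 ≤ r) (hrR : r ≤ R) :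
    volume (ball (0 : EuclideanSpace ℝ (Fin m)) R \ ball 0 r) ≤
      ENNReal.ofReal (m * R ^ (m - 1) * (R - r)) *
        volume (ball (0 : EuclideanSpace ℝ (Fin m)) 1) := by
  rw [measure_sdiff (ball_subset_ball hrR) measurableSet_ball.nullMeasurableSet
    measure_ball_lt_top.ne, volume_ball_eq 0 hr, volume_ball_eq 0 (hr.trans hrR),
    ← ENNReal.sub_mul (fun _ _ => measure_ball_lt_top.ne), ← ENNReal.ofReal_sub _ (by positivity)]
  gcongr
  have h := abs_pow_sub_pow_le R r m
  rw [abs_of_nonneg (sub_nonneg.2 hrR), abs_of_nonneg hr, abs_of_nonneg (hr.trans hrR),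
    max_eq_left hrR] at h
  linarith [le_abs_self (R ^ m - r ^ m)]

/-- From a point outside a ball centred at the origin, at most as much heat flows into the ball
as out of it. -/
theorem setLIntegral_ball_le_compl {r : ℝ} {x : EuclideanSpace ℝ (Fin m)} (hx : x ∉ ball 0 r) :
    ∫⁻ y in ball 0 r, gaussKernel t (x - y) ≤ ∫⁻ y in (ball 0 r)ᶜ, gaussKernel t (x - y) := by
  have hmp : MeasurePreserving (fun y : EuclideanSpace ℝ (Fin m) => (x + x) - y) :=
    Measure.measurePreserving_sub_left volume (x + x)
  have hemb : MeasurableEmbedding (fun y : EuclideanSpace ℝ (Fin m) => (x + x) - y) :=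
    (MeasurableEquiv.subLeft (x + x)).measurableEmbedding
  rw [← hmp.setLIntegral_comp_preimage_emb hemb _ (ball 0 r)ᶜ]
  have hk : ∀ y, gaussKernel t (x - (x + x - y)) = gaussKernel t (x - y) := by
    intro y
    rw [← gaussKernel_neg]
    congr 1
    abel
  simp only [hk]
  refine lintegral_mono_set fun y hy => ?_
  simp only [Set.mem_preimage, Set.mem_compl_iff, mem_ball_zero_iff, not_lt] at hx hy ⊢
  have h := norm_add_le (x + x - y) y
  rw [sub_add_cancel, ← two_smul ℝ x, norm_smul, Real.norm_ofNat, two_smul] at h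
  linarith

theorem ballHeatLoss_le_add {r R : ℝ} (hrR : r ≤ R) :
    ballHeatLoss m t r ≤ ballHeatLoss m t R +
      heatFlow t (ball (0 : EuclideanSpace ℝ (Fin m)) R \ ball 0 r) (ball 0 R \ ball 0 r) := by
  set b := ball (0 : EuclideanSpace ℝ (Fin m)) r with hb
  set B := ball (0 : EuclideanSpace ℝ (Fin m)) R with hB
  have hbB : b ⊆ B := ball_subset_ball hrR
  have hbm : MeasurableSet b := measurableSet_ball
  have hBm : MeasurableSet B := measurableSet_ball
  have hcompl : bᶜ = (B \ b) ∪ Bᶜ := by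
    ext x
    have := @hbB x
    simp only [Set.mem_compl_iff, Set.mem_union, Set.mem_sdiff]
    tauto
  have hdisj : Disjoint (B \ b) Bᶜ := Set.disjoint_left.2 fun x hx hx' => hx' hx.1
  have h1 : ballHeatLoss m t r = heatFlow t b (B \ b) + heatFlow t b Bᶜ := by
    rw [ballHeatLoss, ← hb, ← heatFlow_union_right hBm.compl hdisj, ← hcompl]
  have h2 : ballHeatLoss m t R = heatFlow t b Bᶜ + heatFlow t (B \ b) Bᶜ := by
    rw [ballHeatLoss, ← hB, ← heatFlow_union_left (hBm.diff hbm) Set.disjoint_sdiff_right,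
      Set.union_sdiff_cancel hbB]
  have h3 : heatFlow t (B \ b) b ≤ heatFlow t (B \ b) (B \ b) + heatFlow t (B \ b) Bᶜ := by
    rw [← heatFlow_union_right hBm.compl hdisj, ← hcompl]
    exact setLIntegral_mono' (hBm.diff hbm) fun x hx => setLIntegral_ball_le_compl hx.2
  rw [h1, h2, heatFlow_comm b (B \ b)]
  calc heatFlow t (B \ b) b + heatFlow t b Bᶜ
      ≤ heatFlow t (B \ b) (B \ b) + heatFlow t (B \ b) Bᶜ + heatFlow t b Bᶜ := by gcongr
    _ = _ := by ring

theorem ballHeatLoss_lt_top (ht : 0 < t) (ρ : ℝ) : ballHeatLoss m t ρ < ∞ :=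
  (heatFlow_le_volume ht _ _).trans_lt measure_ball_lt_top

theorem ballHeatLoss_mono [NeZero m] (ht : 0 < t) {r R : ℝ} (hr : 0 ≤ r) (hrR : r ≤ R) :
    ballHeatLoss m t r ≤ ballHeatLoss m t R := by
  rw [← ENNReal.toReal_le_toReal (ballHeatLoss_lt_top ht r).ne (ballHeatLoss_lt_top ht R).ne]
  set ω := (volume (ball (0 : EuclideanSpace ℝ (Fin m)) 1)).toReal with hω
  have hω' : volume (ball (0 : EuclideanSpace ℝ (Fin m)) 1) = ENNReal.ofReal ω :=
    (ENNReal.ofReal_toReal measure_ball_lt_top.ne).symm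
  have hω0 : 0 ≤ ω := ENNReal.toReal_nonneg
  refine le_of_le_add_mul_sq (f := fun ρ => (ballHeatLoss m t ρ).toReal)
    (C := (4 * Real.pi * t) ^ (-(m : ℝ) / 2) * (m * R ^ (m - 1) * ω) ^ 2) ?_ hrR
  intro x y hx hxy hy
  have hx0 : 0 ≤ x := hr.trans hx
  have hy0 : 0 ≤ y := hx0.trans hxy
  have hvol : volume (ball (0 : EuclideanSpace ℝ (Fin m)) y \ ball 0 x) ≤
      ENNReal.ofReal (m * R ^ (m - 1) * ω * (y - x)) := by
    refine (volume_annulus_le hx0 hxy).trans ?_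
    have hyx : 0 ≤ y - x := sub_nonneg.2 hxy
    rw [hω', ← ENNReal.ofReal_mul (by positivity), mul_right_comm]
    gcongr
  have h := (ballHeatLoss_le_add (m := m) hxy).trans
    (add_le_add le_rfl ((heatFlow_le_mul_volume_sq ht _).trans
      (mul_le_mul_right (pow_le_pow_left' hvol 2) _)))
  have hyx : 0 ≤ y - x := sub_nonneg.2 hxy
  have hR : 0 ≤ R := hr.trans hrR
  rw [← ENNReal.ofReal_pow (by positivity), ← ENNReal.ofReal_mul (by positivity)] at h
  have h' := ENNReal.toReal_mono (by finiteness [(ballHeatLoss_lt_top (m := m) ht y).ne]) h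
  rw [ENNReal.toReal_add (ballHeatLoss_lt_top ht y).ne ENNReal.ofReal_ne_top,
    ENNReal.toReal_ofReal (by positivity)] at h'
  convert h' using 2
  ring

theorem volume_ball_inter_sub_notMem_le [NeZero m] {ρ : ℝ} (hρ : 0 ≤ ρ)
    (w : EuclideanSpace ℝ (Fin m)) :
    volume (ball (0 : EuclideanSpace ℝ (Fin m)) ρ ∩ {x | x - w ∈ (ball 0 ρ)ᶜ}) ≤
      ENNReal.ofReal (m * ρ ^ (m - 1) * ‖w‖) *
        volume (ball (0 : EuclideanSpace ℝ (Fin m)) 1) := by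
  have hsub : ball (0 : EuclideanSpace ℝ (Fin m)) ρ ∩ {x | x - w ∈ (ball 0 ρ)ᶜ} ⊆
      ball 0 ρ \ ball 0 (max 0 (ρ - ‖w‖)) := by
    rintro x ⟨hx, hxw⟩
    refine ⟨hx, fun hx' => ?_⟩
    simp only [Set.mem_ofPred_eq, Set.mem_compl_iff, mem_ball_zero_iff, not_lt, lt_max_iff]
      at hx' hxw
    rcases hx' with h | h
    · exact absurd h (norm_nonneg x).not_gt
    · linarith [norm_sub_le x w]
  refine (measure_mono hsub).trans ((volume_annulus_le (le_max_left _ _)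
    (max_le hρ (by linarith [norm_nonneg w]))).trans ?_)
  gcongr
  linarith [le_max_right 0 (ρ - ‖w‖)]

/-- The heat loss of a ball is at most a constant times its perimeter times `√t`. -/
theorem ballHeatLoss_le_sqrt [NeZero m] (ht : 0 < t) {ρ : ℝ} (hρ : 0 ≤ ρ) :
    ballHeatLoss m t ρ ≤ volume (ball (0 : EuclideanSpace ℝ (Fin m)) 1) *
      ENNReal.ofReal (m * ρ ^ (m - 1) * (2 ^ ((m : ℝ) / 2) * (2 * √t))) := by
  set B := ball (0 : EuclideanSpace ℝ (Fin m)) ρ with hB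
  have hBm : MeasurableSet B := measurableSet_ball
  have hinner : ∀ x : EuclideanSpace ℝ (Fin m), ∫⁻ y in Bᶜ, gaussKernel t (x - y) =
      ∫⁻ w, gaussKernel t w * Bᶜ.indicator 1 (x - w) := by
    intro x
    rw [← lintegral_indicator hBm.compl, ← lintegral_sub_left_eq_self _ x]
    refine lintegral_congr fun w => ?_
    by_cases hw : x - w ∈ Bᶜ <;> simp [hw]
  have hmeas : Measurable (Function.uncurry fun x w : EuclideanSpace ℝ (Fin m) =>
      gaussKernel t w * Bᶜ.indicator (1 : EuclideanSpace ℝ (Fin m) → ℝ≥0∞) (x - w)) :=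
    (measurable_gaussKernel.comp measurable_snd).mul
      ((measurable_one.indicator hBm.compl).comp (measurable_fst.sub measurable_snd))
  have hvol : ∀ w : EuclideanSpace ℝ (Fin m),
      ∫⁻ x in B, gaussKernel t w * Bᶜ.indicator 1 (x - w) =
        gaussKernel t w * volume (B ∩ {x | x - w ∈ Bᶜ}) := by
    intro w
    have hS : MeasurableSet {x : EuclideanSpace ℝ (Fin m) | x - w ∈ Bᶜ} :=
      hBm.compl.preimage (measurable_id.sub_const w)
    have hind : (fun x => Bᶜ.indicator (1 : EuclideanSpace ℝ (Fin m) → ℝ≥0∞) (x - w)) =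
        {x : EuclideanSpace ℝ (Fin m) | x - w ∈ Bᶜ}.indicator 1 := rfl
    rw [lintegral_const_mul _ (by rw [hind]; exact measurable_one.indicator hS), hind,
      lintegral_indicator_one hS, Measure.restrict_apply hS, Set.inter_comm]
  calc ballHeatLoss m t ρ
      = ∫⁻ x in B, ∫⁻ w, gaussKernel t w * Bᶜ.indicator 1 (x - w) := by
        simp only [ballHeatLoss, heatFlow, ← hB, hinner]
    _ = ∫⁻ w, ∫⁻ x in B, gaussKernel t w * Bᶜ.indicator 1 (x - w) :=
        lintegral_lintegral_swap hmeas.aemeasurable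
    _ = ∫⁻ w, gaussKernel t w * volume (B ∩ {x | x - w ∈ Bᶜ}) := lintegral_congr hvol
    _ ≤ ∫⁻ w : EuclideanSpace ℝ (Fin m), (volume (ball (0 : EuclideanSpace ℝ (Fin m)) 1) *
          ENNReal.ofReal (m * ρ ^ (m - 1))) * (gaussKernel t w * ENNReal.ofReal ‖w‖) := by
        refine lintegral_mono fun w => ?_
        calc gaussKernel t w * volume (B ∩ {x | x - w ∈ Bᶜ})
            ≤ gaussKernel t w * (ENNReal.ofReal (m * ρ ^ (m - 1) * ‖w‖) *
                volume (ball (0 : EuclideanSpace ℝ (Fin m)) 1)) := by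
              gcongr
              exact volume_ball_inter_sub_notMem_le hρ w
          _ = _ := by rw [ENNReal.ofReal_mul (by positivity)]; ring
    _ ≤ (volume (ball (0 : EuclideanSpace ℝ (Fin m)) 1) * ENNReal.ofReal (m * ρ ^ (m - 1))) *
          ENNReal.ofReal (2 ^ ((m : ℝ) / 2) * (2 * √t)) := by
        have hmom : Measurable fun w : EuclideanSpace ℝ (Fin m) =>
            gaussKernel t w * ENNReal.ofReal ‖w‖ :=
          measurable_gaussKernel.mul measurable_norm.ennreal_ofReal
        rw [lintegral_const_mul _ hmom]
        gcongr
        exact lintegral_gaussKernel_mul_norm_le ht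
    _ = _ := by rw [mul_assoc, ← ENNReal.ofReal_mul (by positivity)]

theorem setLIntegral_scale {ρ : ℝ} (hρ : 0 < ρ) {f : EuclideanSpace ℝ (Fin m) → ℝ≥0∞}
    (s : Set (EuclideanSpace ℝ (Fin m))) :
    ∫⁻ x in s, f x = ENNReal.ofReal (ρ ^ m) * ∫⁻ x in (fun x => ρ • x) ⁻¹' s, f (ρ • x) := by
  have hemb : MeasurableEmbedding fun x : EuclideanSpace ℝ (Fin m) => ρ • x :=
    (Homeomorph.smulOfNeZero ρ hρ.ne').measurableEmbedding
  rw [← hemb.lintegral_map, ← hemb.restrict_map, Measure.map_addHaar_smul _ hρ.ne',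
    finrank_euclideanSpace_fin, abs_of_pos (by positivity), Measure.restrict_smul,
    lintegral_smul_measure, smul_eq_mul, ← mul_assoc, ← ENNReal.ofReal_mul (by positivity),
    mul_inv_cancel₀ (by positivity), ENNReal.ofReal_one, one_mul]

theorem ballHeatLoss_scale {ρ : ℝ} (hρ : 0 < ρ) :
    ballHeatLoss m t ρ = ∫⁻ x in ball (0 : EuclideanSpace ℝ (Fin m)) 1,
      ∫⁻ y in (ball (0 : EuclideanSpace ℝ (Fin m)) 1)ᶜ,
        ENNReal.ofReal (ρ ^ (2 * m)) * gaussKernel t (ρ • (x - y)) := by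
  have hpre : (fun x : EuclideanSpace ℝ (Fin m) => ρ • x) ⁻¹' ball 0 ρ = ball 0 1 := by
    ext x
    simp only [Set.mem_preimage, mem_ball_zero_iff, norm_smul, Real.norm_of_nonneg hρ.le]
    exact mul_lt_iff_lt_one_right hρ
  have hk : Measurable (Function.uncurry fun x y : EuclideanSpace ℝ (Fin m) =>
      gaussKernel t (ρ • (x - y))) :=
    measurable_gaussKernel.comp ((measurable_fst.sub measurable_snd).const_smul ρ)
  unfold ballHeatLoss heatFlow
  rw [setLIntegral_scale hρ, hpre, ← lintegral_const_mul]
  · refine lintegral_congr fun x => ?_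
    rw [setLIntegral_scale hρ, Set.preimage_compl, hpre, ← mul_assoc,
      ← ENNReal.ofReal_mul (by positivity), ← pow_add, ← two_mul,
      lintegral_const_mul _ (hk.of_uncurry_left (x := x))]
    simp only [smul_sub]
  · exact (measurable_setLIntegral_gaussKernel _).comp (measurable_const_smul ρ)

end BallHeatLoss

/-- The factor in front of the double integral in the leading coefficient of the heat loss. -/
noncomputable def heatLossFactor (m : ℕ) (a α : ℝ) : ℝ :=
  2 ^ ((m : ℝ) - 1 - 1 / α) * Real.pi ^ (-(m : ℝ) / 2) * α⁻¹ *
    Real.Gamma ((2 * (m : ℝ) * α - 1) / (2 * α)) * a ^ (1 / α)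

theorem heatLossFactor_pos {m : ℕ} {a α : ℝ} (ha : 0 < a) (hα : 0 < α) (hmα : 1 < m * α) :
    0 < heatLossFactor m a α := by
  have hΓ : 0 < Real.Gamma ((2 * (m : ℝ) * α - 1) / (2 * α)) :=
    Real.Gamma_pos_of_pos (div_pos (by linarith) (by linarith))
  have hπ := Real.pi_pos
  unfold heatLossFactor
  positivity

section RadialIntegral

variable {m : ℕ} {t a α : ℝ}

theorem lintegral_Ioi_rpow_mul_gaussKernel (ht : 0 < t) (ha : 0 < a) (hα : 0 < α)
    (hmα : 1 < m * α) {w : EuclideanSpace ℝ (Fin m)} (hw : w ≠ 0) :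
    ∫⁻ s in Set.Ioi (0 : ℝ), ENNReal.ofReal ((a * s ^ (-α)) ^ (2 * m)) *
        gaussKernel t ((a * s ^ (-α)) • w) =
      ENNReal.ofReal (heatLossFactor m a α * t ^ (((m : ℝ) * α - 1) / (2 * α))) *
        ENNReal.ofReal (‖w‖ ^ ((1 - 2 * (m : ℝ) * α) / α)) := by
  have hD : 0 < ‖w‖ := norm_pos_iff.2 hw
  set D := ‖w‖ with hDdef
  have hπ := Real.pi_pos
  set q : ℝ := (2 * (m : ℝ) * α - 1) / (2 * α) with hq
  have hq0 : 0 < q := div_pos (by linarith) (by linarith)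
  set b : ℝ := (a * D) ^ 2 / (4 * t) with hb
  have hb0 : 0 < b := by positivity
  set A : ℝ := a ^ (2 * m) * (4 * Real.pi * t) ^ (-(m : ℝ) / 2) / (2 * α) with hA
  have hA0 : 0 < A := by positivity
  have hΓ : 0 < Real.Gamma q := Real.Gamma_pos_of_pos hq0
  set h : ℝ → ℝ := fun u => A * (u ^ (q - 1) * Real.exp (-(b * u))) with hh
  have hp : -2 * α ≠ 0 := by linarith
  have hval : ∫ u in Set.Ioi (0 : ℝ), h u = A * ((1 / b) ^ q * Real.Gamma q) := by
    rw [hh, integral_const_mul, Real.integral_rpow_mul_exp_neg_mul_Ioi hq0 hb0]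
  have hint : IntegrableOn h (Set.Ioi 0) := by
    refine Integrable.of_integral_ne_zero ?_
    rw [hval]
    positivity
  have hcongr : ∀ s ∈ Set.Ioi (0 : ℝ), ENNReal.ofReal ((a * s ^ (-α)) ^ (2 * m)) *
      gaussKernel t ((a * s ^ (-α)) • w) =
        ENNReal.ofReal ((|-2 * α| * s ^ (-2 * α - 1)) • h (s ^ (-2 * α))) := by
    intro s hs
    have hs0 : (0 : ℝ) < s := hs
    rw [gaussKernel, ← ENNReal.ofReal_mul (by positivity)]
    congr 1
    have habs : |-2 * α| = 2 * α := by rw [abs_of_neg (by linarith)]; ring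
    have hsq : (s ^ (-α)) ^ 2 = s ^ (-2 * α) := by
      rw [← Real.rpow_natCast, ← Real.rpow_mul hs0.le]
      congr 1
      push_cast
      ring
    have hexp : -‖(a * s ^ (-α)) • w‖ ^ 2 / (4 * t) = -(b * s ^ (-2 * α)) := by
      rw [norm_smul, Real.norm_of_nonneg (by positivity), ← hsq, hb, ← hDdef]
      field_simp
    have hpow : s ^ (-2 * α - 1) * (s ^ (-2 * α)) ^ (q - 1) = (s ^ (-α)) ^ (2 * m) := by
      rw [← Real.rpow_natCast, ← Real.rpow_mul hs0.le, ← Real.rpow_mul hs0.le,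
        ← Real.rpow_add hs0]
      congr 1
      push_cast
      rw [hq]
      field_simp
      ring
    rw [hexp, hh, habs, mul_pow, ← hpow, smul_eq_mul, hA]
    field_simp
  rw [setLIntegral_congr_fun measurableSet_Ioi hcongr, ← ofReal_integral_eq_lintegral_ofReal
    ((integrableOn_Ioi_comp_rpow_iff h hp).2 hint), integral_comp_rpow_Ioi h hp, hval,
    ← ENNReal.ofReal_mul (by have := heatLossFactor_pos ha hα hmα; positivity)]
  · congr 1
    have e1 : (1 / b) ^ q = (4 * t) ^ q * (a ^ (-2 * q) * D ^ (-2 * q)) := by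
      rw [hb, one_div_div, Real.div_rpow (by positivity) (by positivity),
        ← Real.rpow_natCast (a * D) 2, ← Real.rpow_mul (by positivity),
        ← Real.mul_rpow ha.le hD.le, neg_mul, Real.rpow_neg (by positivity), div_eq_mul_inv]
      norm_num
    have e2 : (4 * Real.pi * t) ^ (-(m : ℝ) / 2) =
        Real.pi ^ (-(m : ℝ) / 2) * (4 * t) ^ (-(m : ℝ) / 2) := by
      rw [← Real.mul_rpow hπ.le (by positivity)]
      congr 1
      ring
    have e3 : a ^ (2 * m) * a ^ (-2 * q) = a ^ (1 / α) := by
      rw [← Real.rpow_natCast, ← Real.rpow_add ha]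
      congr 1
      rw [hq]
      push_cast
      field_simp
      ring
    have e4 : (4 * t) ^ (-(m : ℝ) / 2) * (4 * t) ^ q =
        2 * 2 ^ ((m : ℝ) - 1 - 1 / α) * t ^ (((m : ℝ) * α - 1) / (2 * α)) := by
      have hexp : -(m : ℝ) / 2 + q = ((m : ℝ) * α - 1) / (2 * α) := by
        rw [hq]
        field_simp
        ring
      rw [← Real.rpow_add (by positivity), hexp, Real.mul_rpow (by norm_num) ht.le]
      congr 1
      rw [← Real.rpow_one_add' (by norm_num) (by
          have : (m : ℝ) - 1 / α ≠ 0 := by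
            rw [sub_ne_zero]
            intro h0
            rw [h0] at hmα
            field_simp at hmα
            exact lt_irrefl _ hmα
          intro h1
          apply this
          linarith),
        show (4 : ℝ) = 2 ^ (2 : ℝ) by norm_num, ← Real.rpow_mul (by norm_num)]
      congr 1
      field_simp
      ring
    have e5 : (1 - 2 * (m : ℝ) * α) / α = -2 * q := by
      rw [hq]
      field_simp
      ring
    rw [e1, hA, e2, e5, heatLossFactor, ← hq, ← e3]
    calc a ^ (2 * m) * (Real.pi ^ (-(m : ℝ) / 2) * (4 * t) ^ (-(m : ℝ) / 2)) / (2 * α) *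
          ((4 * t) ^ q * (a ^ (-2 * q) * D ^ (-2 * q)) * Real.Gamma q)
        = ((4 * t) ^ (-(m : ℝ) / 2) * (4 * t) ^ q) * (a ^ (2 * m) *
          Real.pi ^ (-(m : ℝ) / 2) / (2 * α) * (a ^ (-2 * q) * D ^ (-2 * q)) *
            Real.Gamma q) := by ring
      _ = _ := by
        rw [e4]
        field_simp
  · filter_upwards [ae_restrict_mem measurableSet_Ioi] with s hs
    have hs0 : (0 : ℝ) < s := hs
    simp only [hh, Pi.zero_apply, smul_eq_mul]
    positivity

theorem lintegral_Ioi_ballHeatLoss (ht : 0 < t) (ha : 0 < a) (hα : 0 < α)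
    (hmα : 1 < m * α) :
    ∫⁻ s in Set.Ioi (0 : ℝ), ballHeatLoss m t (a * s ^ (-α)) =
      ENNReal.ofReal (heatLossFactor m a α * t ^ (((m : ℝ) * α - 1) / (2 * α))) *
        ∫⁻ x in ball (0 : EuclideanSpace ℝ (Fin m)) 1,
          ∫⁻ y in (ball (0 : EuclideanSpace ℝ (Fin m)) 1)ᶜ,
            ENNReal.ofReal (‖x - y‖ ^ ((1 - 2 * (m : ℝ) * α) / α)) := by
  set B := ball (0 : EuclideanSpace ℝ (Fin m)) 1 with hB
  set f : ℝ → EuclideanSpace ℝ (Fin m) → EuclideanSpace ℝ (Fin m) → ℝ≥0∞ := fun s x y =>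
    ENNReal.ofReal ((a * s ^ (-α)) ^ (2 * m)) * gaussKernel t ((a * s ^ (-α)) • (x - y)) with hf
  have hfm : Measurable fun p : (ℝ × EuclideanSpace ℝ (Fin m)) × EuclideanSpace ℝ (Fin m) =>
      f p.1.1 p.1.2 p.2 :=
    Measurable.mul (by fun_prop) (measurable_gaussKernel.comp (by fun_prop))
  have hk : Measurable (Function.uncurry fun x y : EuclideanSpace ℝ (Fin m) =>
      ENNReal.ofReal (‖x - y‖ ^ ((1 - 2 * (m : ℝ) * α) / α))) := by
    unfold Function.uncurry
    fun_prop
  have hJ : Measurable fun x : EuclideanSpace ℝ (Fin m) =>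
      ∫⁻ y in Bᶜ, ENNReal.ofReal (‖x - y‖ ^ ((1 - 2 * (m : ℝ) * α) / α)) :=
    hk.lintegral_prod_right'
  have hscale : ∀ s ∈ Set.Ioi (0 : ℝ), ballHeatLoss m t (a * s ^ (-α)) =
      ∫⁻ x in B, ∫⁻ y in Bᶜ, f s x y := fun s hs =>
    ballHeatLoss_scale (mul_pos ha (Real.rpow_pos_of_pos hs _))
  rw [setLIntegral_congr_fun measurableSet_Ioi hscale,
    lintegral_lintegral_swap (f := fun s x => ∫⁻ y in Bᶜ, f s x y)
      hfm.lintegral_prod_right'.aemeasurable,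
    ← lintegral_const_mul _ hJ]
  refine setLIntegral_congr_fun measurableSet_ball fun x hx => ?_
  have hfx : Measurable fun p : ℝ × EuclideanSpace ℝ (Fin m) => f p.1 x p.2 :=
    Measurable.mul (by fun_prop) (measurable_gaussKernel.comp (by fun_prop))
  have hkey : ∀ y ∈ Bᶜ, ∫⁻ s in Set.Ioi (0 : ℝ), f s x y =
      ENNReal.ofReal (heatLossFactor m a α * t ^ (((m : ℝ) * α - 1) / (2 * α))) *
        ENNReal.ofReal (‖x - y‖ ^ ((1 - 2 * (m : ℝ) * α) / α)) := fun y hy =>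
    lintegral_Ioi_rpow_mul_gaussKernel ht ha hα hmα (sub_ne_zero.2 fun h => hy (h ▸ hx))
  calc ∫⁻ s in Set.Ioi (0 : ℝ), ∫⁻ y in Bᶜ, f s x y
      = ∫⁻ y in Bᶜ, ∫⁻ s in Set.Ioi (0 : ℝ), f s x y :=
        lintegral_lintegral_swap (f := fun s y => f s x y) hfx.aemeasurable
    _ = ∫⁻ y in Bᶜ, ENNReal.ofReal (heatLossFactor m a α * t ^ (((m : ℝ) * α - 1) / (2 * α))) *
        ENNReal.ofReal (‖x - y‖ ^ ((1 - 2 * (m : ℝ) * α) / α)) :=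
        setLIntegral_congr_fun measurableSet_ball.compl hkey
    _ = _ := lintegral_const_mul _ (hk.of_uncurry_left (x := x))

end RadialIntegral

section IntegralComparison

variable {g : ℝ → ℝ≥0∞}

theorem Ioi_one_eq_iUnion_Ioc : Set.Ioi (1 : ℝ) = ⋃ i : ℕ, Set.Ioc ((i : ℝ) + 1) (i + 2) := by
  ext s
  simp only [Set.mem_Ioi, Set.mem_iUnion, Set.mem_Ioc]
  constructor
  · intro hs
    have h1 : 1 < ⌈s⌉₊ := Nat.lt_ceil.2 (by exact_mod_cast hs)
    obtain ⟨n, hn⟩ := Nat.exists_eq_add_of_lt h1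
    refine ⟨n, ?_, ?_⟩
    · have h : n + 1 < ⌈s⌉₊ := by omega
      exact_mod_cast Nat.lt_ceil.1 h
    · have h : ⌈s⌉₊ ≤ n + 2 := by omega
      exact_mod_cast Nat.ceil_le.1 h
  · rintro ⟨i, hi, -⟩
    linarith [i.cast_nonneg (α := ℝ)]

theorem lintegral_Ioi_one_eq_tsum :
    ∫⁻ s in Set.Ioi (1 : ℝ), g s = ∑' i : ℕ, ∫⁻ s in Set.Ioc ((i : ℝ) + 1) (i + 2), g s := by
  rw [Ioi_one_eq_iUnion_Ioc, lintegral_iUnion fun i => measurableSet_Ioc]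
  intro i j hij
  refine Set.disjoint_left.2 fun s hi hj => hij ?_
  have h1 : (i : ℝ) < j + 1 := by linarith [hi.1, hj.2]
  have h2 : (j : ℝ) < i + 1 := by linarith [hi.2, hj.1]
  norm_cast at h1 h2
  omega

theorem lintegral_Ioi_one_le_tsum (hg : AntitoneOn g (Set.Ici 1)) :
    ∫⁻ s in Set.Ioi (1 : ℝ), g s ≤ ∑' i : ℕ, g (i + 1) := by
  rw [lintegral_Ioi_one_eq_tsum]
  refine ENNReal.tsum_le_tsum fun i => ?_
  have hi : (1 : ℝ) ≤ i + 1 := by linarith [i.cast_nonneg (α := ℝ)]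
  calc ∫⁻ s in Set.Ioc ((i : ℝ) + 1) (i + 2), g s
      ≤ ∫⁻ _ in Set.Ioc ((i : ℝ) + 1) (i + 2), g (i + 1) :=
        setLIntegral_mono' measurableSet_Ioc fun s hs => hg hi (hi.trans hs.1.le) hs.1.le
    _ = g (i + 1) := by
        rw [setLIntegral_const, Real.volume_Ioc]
        norm_num

theorem tsum_le_add_lintegral_Ioi_one (hg : AntitoneOn g (Set.Ici 1)) :
    ∑' i : ℕ, g (i + 1) ≤ g 1 + ∫⁻ s in Set.Ioi (1 : ℝ), g s := by
  rw [lintegral_Ioi_one_eq_tsum, tsum_eq_zero_add' ENNReal.summable]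
  simp only [Nat.cast_zero, zero_add, Nat.cast_add, Nat.cast_one]
  gcongr with i
  have hi : (1 : ℝ) ≤ i + 1 := by linarith [i.cast_nonneg (α := ℝ)]
  calc g (i + 1 + 1) = ∫⁻ _ in Set.Ioc ((i : ℝ) + 1) (i + 2), g (i + 1 + 1) := by
        rw [setLIntegral_const, Real.volume_Ioc]
        norm_num
    _ ≤ ∫⁻ s in Set.Ioc ((i : ℝ) + 1) (i + 2), g s :=
        setLIntegral_mono' measurableSet_Ioc fun s hs =>
          hg (hi.trans hs.1.le) (by simp only [Set.mem_Ici]; linarith) (by linarith [hs.2])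

end IntegralComparison

theorem exists_lintegral_Ioc_ballHeatLoss_le {m : ℕ} [NeZero m] {a α : ℝ} (ha : 0 ≤ a)
    (hmα : α * ((m : ℝ) - 1) < 1) :
    ∃ C : ℝ≥0∞, C ≠ ∞ ∧ ∀ t : ℝ, 0 < t →
      ∫⁻ s in Set.Ioc (0 : ℝ) 1, ballHeatLoss m t (a * s ^ (-α)) ≤ C * ENNReal.ofReal √t := by
  have hint : IntegrableOn (fun s : ℝ => s ^ (-α * ((m : ℝ) - 1))) (Set.Ioc 0 1) :=
    (intervalIntegral.intervalIntegrable_rpow' (by linarith)).1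
  set c := volume (ball (0 : EuclideanSpace ℝ (Fin m)) 1) *
    ENNReal.ofReal (m * a ^ (m - 1) * (2 ^ ((m : ℝ) / 2) * 2)) with hc
  refine ⟨c * ∫⁻ s in Set.Ioc (0 : ℝ) 1, ENNReal.ofReal (s ^ (-α * ((m : ℝ) - 1))),
    ENNReal.mul_ne_top (ENNReal.mul_ne_top measure_ball_lt_top.ne ENNReal.ofReal_ne_top)
      hint.lintegral_lt_top.ne, fun t ht => ?_⟩
  calc ∫⁻ s in Set.Ioc (0 : ℝ) 1, ballHeatLoss m t (a * s ^ (-α))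
      ≤ ∫⁻ s in Set.Ioc (0 : ℝ) 1,
          (c * ENNReal.ofReal √t) * ENNReal.ofReal (s ^ (-α * ((m : ℝ) - 1))) := by
        refine setLIntegral_mono' measurableSet_Ioc fun s hs => ?_
        have hs0 : 0 < s := hs.1
        refine (ballHeatLoss_le_sqrt ht (by positivity)).trans_eq ?_
        have hpow : (s ^ (-α)) ^ (m - 1) = s ^ (-α * ((m : ℝ) - 1)) := by
          rw [← Real.rpow_natCast, ← Real.rpow_mul hs0.le, Nat.cast_pred (NeZero.pos m)]
        have hsplit : m * (a * s ^ (-α)) ^ (m - 1) * (2 ^ ((m : ℝ) / 2) * (2 * √t)) =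
            m * a ^ (m - 1) * (2 ^ ((m : ℝ) / 2) * 2) * √t * s ^ (-α * ((m : ℝ) - 1)) := by
          rw [mul_pow, hpow]
          ring
        rw [hsplit, ENNReal.ofReal_mul (by positivity), ENNReal.ofReal_mul (by positivity), hc]
        ring
    _ = _ := by
        rw [lintegral_const_mul _ (by fun_prop)]
        ring

theorem IsLatticeEnum.one_le_dist {m : ℕ} {z : ℕ → EuclideanSpace ℝ (Fin m)}
    (hz : IsLatticeEnum m z) {i j : ℕ} (hij : i ≠ j) : 1 ≤ dist (z i) (z j) := by
  have hmem : ∀ i, ∀ l : Fin m, ∃ k : ℤ, z i l = k := fun i => by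
    have : z i ∈ Set.range z := Set.mem_range_self i
    rwa [hz.2] at this
  obtain ⟨l, hl⟩ : ∃ l, z i l ≠ z j l := by
    by_contra! h
    exact hij (hz.1 (PiLp.ext h))
  obtain ⟨p, hp⟩ := hmem i l
  obtain ⟨q, hq⟩ := hmem j l
  rw [dist_eq_norm]
  refine le_trans ?_ (PiLp.norm_apply_le (z i - z j) l)
  rw [PiLp.sub_apply, hp, hq, Real.norm_eq_abs]
  have hpq : p - q ≠ 0 := fun h => hl (by rw [hp, hq, sub_eq_zero.1 h])
  exact_mod_cast Int.one_le_abs hpq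

section SeparatedUnion

variable {m : ℕ} {t : ℝ} {b : ℕ → Set (EuclideanSpace ℝ (Fin m))}

theorem heatFlow_iUnion_left (hb : ∀ i, MeasurableSet (b i))
    (hd : Pairwise (Function.onFun Disjoint b)) (C : Set (EuclideanSpace ℝ (Fin m))) :
    heatFlow t (⋃ i, b i) C = ∑' i, heatFlow t (b i) C :=
  lintegral_iUnion hb hd _

theorem heatFlow_iUnion_compl_le_tsum (hb : ∀ i, MeasurableSet (b i))
    (hd : Pairwise (Function.onFun Disjoint b)) :
    heatFlow t (⋃ i, b i) (⋃ i, b i)ᶜ ≤ ∑' i, heatFlow t (b i) (b i)ᶜ := by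
  rw [heatFlow_iUnion_left hb hd]
  exact ENNReal.tsum_le_tsum fun i => lintegral_mono fun x =>
    lintegral_mono_set (Set.compl_subset_compl.2 (Set.subset_iUnion b i))

theorem tsum_heatFlow_compl_le (ht : 0 < t) (ht1 : t ≤ 1) (hb : ∀ i, MeasurableSet (b i))
    (hd : Pairwise (Function.onFun Disjoint b))
    (hsep : ∀ i j, i ≠ j → ∀ x ∈ b i, ∀ y ∈ b j, 1 / 2 ≤ ‖x - y‖) :
    ∑' i, heatFlow t (b i) (b i)ᶜ ≤ heatFlow t (⋃ i, b i) (⋃ i, b i)ᶜ +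
      volume (⋃ i, b i) * ENNReal.ofReal (2 ^ ((m : ℝ) / 2) * (32 * √t)) := by
  have hΩ : MeasurableSet (⋃ i, b i) := MeasurableSet.iUnion hb
  rw [heatFlow_iUnion_left hb hd, measure_iUnion hd hb, ← ENNReal.tsum_mul_right,
    ← ENNReal.tsum_add]
  refine ENNReal.tsum_le_tsum fun i => ?_
  have hcompl : (b i)ᶜ = (⋃ j, b j)ᶜ ∪ ((⋃ j, b j) \ b i) := by
    ext x
    have := @Set.subset_iUnion _ _ b i x
    simp only [Set.mem_compl_iff, Set.mem_union, Set.mem_sdiff]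
    tauto
  have hdisj : Disjoint (⋃ j, b j)ᶜ ((⋃ j, b j) \ b i) :=
    Set.disjoint_left.2 fun x hx hx' => hx hx'.1
  rw [hcompl, heatFlow_union_right (hΩ.diff (hb i)) hdisj]
  gcongr
  refine heatFlow_le_far ht ht1 (hb i) (hΩ.diff (hb i)) fun x hx y hy => ?_
  obtain ⟨j, hj⟩ := Set.mem_iUnion.1 hy.1
  refine hsep i j ?_ x hx y hj
  rintro rfl
  exact hy.2 hj

theorem volume_toReal_sub_heatContent_toReal (ht : 0 < t) {Ω : Set (EuclideanSpace ℝ (Fin m))}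
    (hΩ : MeasurableSet Ω) (hfin : volume Ω ≠ ∞) :
    (volume Ω).toReal - (heatContent Ω t).toReal = (heatFlow t Ω Ωᶜ).toReal := by
  rw [heatContent_eq_heatFlow, ← heatFlow_add_compl ht Ω hΩ, ENNReal.toReal_add,
    add_sub_cancel_left]
  all_goals exact ((heatFlow_le_volume ht _ _).trans_lt hfin.lt_top).ne

end SeparatedUnion

theorem tsum_volume_ball_ne_top {m : ℕ} [NeZero m] {a α : ℝ} (ha : 0 ≤ a) (hmα : 1 < m * α)
    (z : ℕ → EuclideanSpace ℝ (Fin m)) :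
    ∑' i : ℕ, volume (ball (z i) (a * ((i : ℝ) + 1) ^ (-α))) ≠ ∞ := by
  have hsum : Summable fun i : ℕ => a ^ m * (1 / |(i : ℝ) + 1| ^ (m * α)) :=
    ((Real.summable_one_div_nat_add_rpow 1 _).2 hmα).mul_left _
  have hvol : ∀ i : ℕ, volume (ball (z i) (a * ((i : ℝ) + 1) ^ (-α))) =
      ENNReal.ofReal (a ^ m * (1 / |(i : ℝ) + 1| ^ (m * α))) *
        volume (ball (0 : EuclideanSpace ℝ (Fin m)) 1) := by
    intro i
    have hi : (0 : ℝ) < i + 1 := by positivity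
    rw [volume_ball_eq _ (by positivity), mul_pow, ← Real.rpow_natCast (_ ^ _),
      ← Real.rpow_mul hi.le, abs_of_pos hi, one_div, ← Real.rpow_neg hi.le, neg_mul,
      mul_comm α]
  simp_rw [hvol, ENNReal.tsum_mul_right]
  exact ENNReal.mul_ne_top hsum.tsum_ofReal_ne_top measure_ball_lt_top.ne

theorem abs_toReal_sub_toReal_le {x y c : ℝ≥0∞} (hx : x ≠ ∞) (hy : y ≠ ∞) (hc : c ≠ ∞)
    (hxy : x ≤ y + c) (hyx : y ≤ x + c) : |x.toReal - y.toReal| ≤ c.toReal := by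
  have h1 := ENNReal.toReal_mono (ENNReal.add_ne_top.2 ⟨hy, hc⟩) hxy
  have h2 := ENNReal.toReal_mono (ENNReal.add_ne_top.2 ⟨hx, hc⟩) hyx
  rw [ENNReal.toReal_add hy hc] at h1
  rw [ENNReal.toReal_add hx hc] at h2
  rw [abs_le]
  constructor <;> linarith

theorem setIntegral_setIntegral_eq_toReal {m : ℕ} {A B : Set (EuclideanSpace ℝ (Fin m))} {p : ℝ}
    (hfin : ∫⁻ x in A, ∫⁻ y in B, ENNReal.ofReal (‖x - y‖ ^ p) ≠ ∞) :
    ∫ x in A, ∫ y in B, ‖x - y‖ ^ p =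
      (∫⁻ x in A, ∫⁻ y in B, ENNReal.ofReal (‖x - y‖ ^ p)).toReal := by
  have hk : Measurable (Function.uncurry fun x y : EuclideanSpace ℝ (Fin m) =>
      ENNReal.ofReal (‖x - y‖ ^ p)) := by
    unfold Function.uncurry
    fun_prop
  have hinner : ∀ x : EuclideanSpace ℝ (Fin m), ∫ y in B, ‖x - y‖ ^ p =
      (∫⁻ y in B, ENNReal.ofReal (‖x - y‖ ^ p)).toReal := fun x =>
    integral_eq_lintegral_of_nonneg_ae (Filter.Eventually.of_forall fun y => by positivity)
      (Measurable.aestronglyMeasurable (by fun_prop))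
  have hJ : Measurable fun x : EuclideanSpace ℝ (Fin m) =>
      ∫⁻ y in B, ENNReal.ofReal (‖x - y‖ ^ p) := hk.lintegral_prod_right'
  simp_rw [hinner]
  exact integral_toReal hJ.aemeasurable (ae_lt_top hJ hfin)

/-- Theorem 4, second regime `1/m < α < 1/(m-1)`: for `Ω` the union of the balls
`B(z_i; a i^{-α})` centred at the points of `ℤᵐ`, the heat loss satisfies
`F_Ω(t) = d_{α,m} t^{(mα-1)/(2α)} + O(t^{1/2})` as `t ↓ 0`, where
`d_{α,m} = 2^{m-1-1/α} π^{-m/2} α⁻¹ Γ((2mα-1)/(2α)) a^{1/α}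
  ∫_{B(0;1)} ∫_{ℝᵐ∖B(0;1)} |x-y|^{(1-2mα)/α} dy dx`. -/
theorem heat_loss_asymptotics_infinite_perimeter_regime
    (m : ℕ) (hm : 2 ≤ m) (a α : ℝ) (ha : 0 < a) (ha' : a ≤ 1 / 4)
    (hα₁ : 1 / m < α) (hα₂ : α < 1 / ((m : ℝ) - 1))
    (z : ℕ → EuclideanSpace ℝ (Fin m)) (hz : IsLatticeEnum m z)
    (r : ℕ → ℝ) (hr : ∀ i : ℕ, r i = a * ((i : ℝ) + 1) ^ (-α))
    (Ω : Set (EuclideanSpace ℝ (Fin m))) (hΩ : Ω = ⋃ i : ℕ, ball (z i) (r i))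
    (d : ℝ)
    (hd : d = 2 ^ ((m : ℝ) - 1 - 1 / α) * Real.pi ^ (-(m : ℝ) / 2) * α⁻¹ *
      Real.Gamma ((2 * (m : ℝ) * α - 1) / (2 * α)) * a ^ (1 / α) *
      ∫ x in ball (0 : EuclideanSpace ℝ (Fin m)) 1,
        ∫ y in (ball (0 : EuclideanSpace ℝ (Fin m)) 1)ᶜ,
          ‖x - y‖ ^ ((1 - 2 * (m : ℝ) * α) / α)) :
    volume Ω ≠ ⊤ ∧
    ∃ t₀ > (0 : ℝ), ∃ K > (0 : ℝ), ∀ t : ℝ, 0 < t → t < t₀ →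
      heatContent Ω t ≠ ⊤ ∧
      |((volume Ω).toReal - (heatContent Ω t).toReal) -
          d * t ^ (((m : ℝ) * α - 1) / (2 * α))| ≤ K * Real.sqrt t := by
  have : NeZero m := ⟨by omega⟩
  have hm2 : (2 : ℝ) ≤ m := by exact_mod_cast hm
  have hα : 0 < α := lt_trans (by positivity) hα₁
  have hmα : 1 < m * α := by rwa [div_lt_iff₀' (by linarith)] at hα₁
  have hmα' : α * ((m : ℝ) - 1) < 1 := by rwa [lt_div_iff₀ (by linarith)] at hα₂
  obtain rfl : r = fun i : ℕ => a * ((i : ℝ) + 1) ^ (-α) := funext hr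
  set b : ℕ → Set (EuclideanSpace ℝ (Fin m)) :=
    fun i => ball (z i) (a * ((i : ℝ) + 1) ^ (-α)) with hb
  have hbm : ∀ i, MeasurableSet (b i) := fun i => measurableSet_ball
  have hr4 : ∀ i : ℕ, a * ((i : ℝ) + 1) ^ (-α) ≤ 1 / 4 := fun i =>
    (mul_le_of_le_one_right ha.le (Real.rpow_le_one_of_one_le_of_nonpos
      (by linarith [i.cast_nonneg (α := ℝ)]) (by linarith))).trans ha'
  have hsep : ∀ i j, i ≠ j → ∀ x ∈ b i, ∀ y ∈ b j, 1 / 2 ≤ ‖x - y‖ := by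
    intro i j hij x hx y hy
    rw [← dist_eq_norm]
    have h1 := hz.one_le_dist hij
    have h2 := dist_triangle4 (z i) x y (z j)
    rw [dist_comm (z i) x] at h2
    have hx' : dist x (z i) < 1 / 4 := (mem_ball.1 hx).trans_le (hr4 i)
    have hy' : dist y (z j) < 1 / 4 := (mem_ball.1 hy).trans_le (hr4 j)
    linarith
  have hdisj : Pairwise (Function.onFun Disjoint b) := fun i j hij =>
    Set.disjoint_left.2 fun x hx hx' => by
      have := hsep i j hij x hx x hx'
      rw [sub_self, norm_zero] at this
      linarith
  have hΩm : MeasurableSet Ω := hΩ ▸ MeasurableSet.iUnion hbm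
  have hvolsum : volume Ω = ∑' i, volume (b i) := by rw [hΩ, measure_iUnion hdisj hbm]
  have hvol : volume Ω ≠ ∞ := hvolsum ▸ tsum_volume_ball_ne_top ha.le hmα z
  have hfin : ∀ t, 0 < t → ∀ B, heatFlow t Ω B ≠ ∞ := fun t ht B =>
    ((heatFlow_le_volume ht Ω B).trans_lt hvol.lt_top).ne
  set S : ℝ → ℝ≥0∞ := fun t => ∑' i : ℕ, ballHeatLoss m t (a * ((i : ℝ) + 1) ^ (-α)) with hS
  have hSb : ∀ t, S t = ∑' i, heatFlow t (b i) (b i)ᶜ := fun t => by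
    simp only [hS, hb, heatFlow_ball_compl]
  have hSfin : ∀ t, 0 < t → S t ≠ ∞ := fun t ht => by
    rw [hSb]
    exact ((ENNReal.tsum_le_tsum fun i => heatFlow_le_volume ht _ _).trans_lt
      (hvolsum ▸ hvol.lt_top)).ne
  set I : ℝ → ℝ≥0∞ := fun t => ∫⁻ s in Set.Ioi (0 : ℝ), ballHeatLoss m t (a * s ^ (-α)) with hI
  have hIsplit : ∀ t, I t = (∫⁻ s in Set.Ioc (0 : ℝ) 1, ballHeatLoss m t (a * s ^ (-α))) +
      ∫⁻ s in Set.Ioi (1 : ℝ), ballHeatLoss m t (a * s ^ (-α)) := fun t => by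
    simp only [hI]
    rw [← lintegral_union measurableSet_Ioi (Set.Ioc_disjoint_Ioi le_rfl),
      Set.Ioc_union_Ioi_eq_Ioi zero_le_one]
  have hanti : ∀ t, 0 < t →
      AntitoneOn (fun s : ℝ => ballHeatLoss m t (a * s ^ (-α))) (Set.Ici 1) := by
    intro t ht s hs s' hs' hss'
    have hs0 : 0 < s := zero_lt_one.trans_le hs
    have hs0' : 0 < s' := zero_lt_one.trans_le hs'
    refine ballHeatLoss_mono ht (by positivity) ?_
    gcongr ?_ * ?_
    exact Real.rpow_le_rpow_of_nonpos hs0 hss' (by linarith)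
  obtain ⟨C₁, hC₁, hIoc⟩ := exists_lintegral_Ioc_ballHeatLoss_le (m := m) ha.le hmα'
  have hIS : ∀ t, 0 < t → I t ≤ S t + C₁ * ENNReal.ofReal √t := fun t ht => by
    rw [hIsplit]
    exact (add_comm _ _).trans_le <| add_le_add (lintegral_Ioi_one_le_tsum (hanti t ht)) (hIoc t ht)
  set C₂ := volume (ball (0 : EuclideanSpace ℝ (Fin m)) 1) *
    ENNReal.ofReal (m * a ^ (m - 1) * (2 ^ ((m : ℝ) / 2) * 2)) with hC₂
  have hSI : ∀ t, 0 < t → S t ≤ I t + C₂ * ENNReal.ofReal √t := fun t ht => by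
    refine (tsum_le_add_lintegral_Ioi_one (hanti t ht)).trans ?_
    refine (add_comm _ _).trans_le (add_le_add (by rw [hIsplit]; exact le_add_self) ?_)
    simp only [Real.one_rpow, mul_one]
    refine (ballHeatLoss_le_sqrt ht ha.le).trans_eq ?_
    have hsplit : m * a ^ (m - 1) * (2 ^ ((m : ℝ) / 2) * (2 * √t)) =
        m * a ^ (m - 1) * (2 ^ ((m : ℝ) / 2) * 2) * √t := by ring
    rw [hsplit, ENNReal.ofReal_mul (by positivity), hC₂, mul_assoc (volume _)]
  have hIfin : ∀ t, 0 < t → I t ≠ ∞ := fun t ht =>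
    ne_top_of_le_ne_top (by finiteness [hSfin t ht]) (hIS t ht)
  set J := ∫⁻ x in ball (0 : EuclideanSpace ℝ (Fin m)) 1,
    ∫⁻ y in (ball (0 : EuclideanSpace ℝ (Fin m)) 1)ᶜ,
      ENNReal.ofReal (‖x - y‖ ^ ((1 - 2 * (m : ℝ) * α) / α)) with hJ
  have hIJ : ∀ t, 0 < t → I t =
      ENNReal.ofReal (heatLossFactor m a α * t ^ (((m : ℝ) * α - 1) / (2 * α))) * J :=
    fun t ht => lintegral_Ioi_ballHeatLoss ht ha hα hmα
  have hfac := heatLossFactor_pos ha hα hmα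
  have hJfin : J ≠ ∞ := by
    intro htop
    have h := hIfin 1 one_pos
    rw [hIJ 1 one_pos, htop, Real.one_rpow, mul_one,
      ENNReal.mul_top (ENNReal.ofReal_pos.2 hfac).ne'] at h
    exact h rfl
  have hdJ : d = heatLossFactor m a α * J.toReal := by
    rw [hd, setIntegral_setIntegral_eq_toReal hJfin, heatLossFactor]
  have hdI : ∀ t, 0 < t → d * t ^ (((m : ℝ) * α - 1) / (2 * α)) = (I t).toReal := fun t ht => by
    rw [hIJ t ht, ENNReal.toReal_mul, ENNReal.toReal_ofReal (by positivity), hdJ]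
    ring
  set C₃ := volume Ω * ENNReal.ofReal (2 ^ ((m : ℝ) / 2) * 32) with hC₃
  set C := C₁ + C₂ + C₃ with hC
  have hCfin : C ≠ ∞ := by
    have : C₂ ≠ ∞ := ENNReal.mul_ne_top measure_ball_lt_top.ne ENNReal.ofReal_ne_top
    have : C₃ ≠ ∞ := ENNReal.mul_ne_top hvol ENNReal.ofReal_ne_top
    finiteness
  refine ⟨hvol, 1, one_pos, C.toReal + 1, by positivity, fun t ht ht1 => ⟨?_, ?_⟩⟩
  · rw [heatContent_eq_heatFlow]
    exact hfin t ht Ω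
  rw [volume_toReal_sub_heatContent_toReal ht hΩm hvol, hdI t ht]
  have hFS : heatFlow t Ω Ωᶜ ≤ S t := by
    rw [hSb, hΩ]
    exact heatFlow_iUnion_compl_le_tsum hbm hdisj
  have hSF : S t ≤ heatFlow t Ω Ωᶜ + C₃ * ENNReal.ofReal √t := by
    have h := tsum_heatFlow_compl_le ht ht1.le hbm hdisj hsep
    rw [← hSb, ← hΩ] at h
    rwa [hC₃, mul_assoc (volume Ω), ← ENNReal.ofReal_mul (by positivity),
      mul_assoc (_ ^ _) 32]
  have hF : heatFlow t Ω Ωᶜ ≤ I t + C * ENNReal.ofReal √t := by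
    refine hFS.trans ((hSI t ht).trans ?_)
    gcongr
    rw [hC]
    exact le_add_self.trans le_self_add
  have hI' : I t ≤ heatFlow t Ω Ωᶜ + C * ENNReal.ofReal √t := by
    calc I t ≤ S t + C₁ * ENNReal.ofReal √t := hIS t ht
      _ ≤ heatFlow t Ω Ωᶜ + C₃ * ENNReal.ofReal √t + C₁ * ENNReal.ofReal √t := by gcongr
      _ = heatFlow t Ω Ωᶜ + (C₁ + C₃) * ENNReal.ofReal √t := by ring
      _ ≤ heatFlow t Ω Ωᶜ + C * ENNReal.ofReal √t := by
        rw [hC]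
        gcongr
        exact le_self_add
  refine (abs_toReal_sub_toReal_le (hfin t ht _) (hIfin t ht)
    (ENNReal.mul_ne_top hCfin ENNReal.ofReal_ne_top) hF hI').trans ?_
  rw [ENNReal.toReal_mul, ENNReal.toReal_ofReal (Real.sqrt_nonneg t)]
  gcongr
  linarith
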